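/- Let (W, S) be a Coxeter system, I ⊆ S, and s ∈ S ∖ I such that W_{I∪{s}} is finite. Suppose conjugation by the longest element w₀^{I∪{s}} of W_{I∪{s}} maps I onto I (i.e. w₀^{I∪{s}} t (w₀^{I∪{s}})⁻¹ ∈ I for all t ∈ I). Then σ_s := w₀^{I∪{s}} w₀^I satisfies σ_s W_I σ_s⁻¹ = W_I and σ_s has minimal length in the coset σ_s W_I; that is, σ_s belongs to the set 𝒲_I of minimal-length elements normalizing W_I. -/

import Mathlib

/-- The standard parabolic subgroup `W_I` of a Coxeter system, generated by the
simple reflections indexed by `I`. -/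
def CoxeterSystem.parabolic {B W : Type*} [Group W] {M : CoxeterMatrix B}
    (cs : CoxeterSystem M W) (I : Set B) : Subgroup W :=
  Subgroup.closure (cs.simple '' I)

/-- The set `𝒲_I` of all `w ∈ W` such that `w W_I w⁻¹ = W_I` and `w` has minimal
length in the coset `w W_I`. -/
def CoxeterSystem.minNormalizing {B W : Type*} [Group W] {M : CoxeterMatrix B}
    (cs : CoxeterSystem M W) (I : Set B) : Set W :=
  {w : W | (cs.parabolic I).map (MulAut.conj w).toMonoidHom = cs.parabolic I ∧
    ∀ u ∈ cs.parabolic I, cs.length w ≤ cs.length (w * u)}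

/-- `w` is the longest element of the standard parabolic subgroup `W_J`:
it lies in `W_J` and has maximal length there. -/
def CoxeterSystem.IsLongestIn {B W : Type*} [Group W] {M : CoxeterMatrix B}
    (cs : CoxeterSystem M W) (J : Set B) (w : W) : Prop :=
  w ∈ cs.parabolic J ∧ ∀ u ∈ cs.parabolic J, cs.length u ≤ cs.length w

namespace CoxeterSystem

variable {B W : Type*} [Group W] {M : CoxeterMatrix B} (cs : CoxeterSystem M W)

open Classical in
/-- The involution `(t, ε) ↦ (s t s, ε + [t = s])` of `W × ZMod 2` attached to a simple
reflection `s`. -/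
noncomputable def signedConj (i : B) : Equiv.Perm (W × ZMod 2) :=
  Function.Involutive.toPerm
    (fun p => (cs.simple i * p.1 * cs.simple i, p.2 + if p.1 = cs.simple i then 1 else 0))
    (by
      rintro ⟨t, e⟩
      have h : cs.simple i * t * cs.simple i = cs.simple i ↔ t = cs.simple i := by
        constructor
        · intro h
          simpa [mul_assoc] using congrArg (fun x => cs.simple i * x * cs.simple i) h
        · rintro rfl
          simp
      ext
      · simp [mul_assoc]
      · by_cases ht : t = cs.simple i
        · simp [ht, add_assoc, CharTwo.add_self_eq_zero]
        · simp [h, ht])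

open Classical in
theorem signedConj_apply (i : B) (p : W × ZMod 2) :
    cs.signedConj i p =
      (cs.simple i * p.1 * cs.simple i, p.2 + if p.1 = cs.simple i then 1 else 0) := rfl

theorem mul_simple_pow_mul (i i' : B) (k : ℕ) :
    (cs.simple i * cs.simple i') ^ k * (cs.simple i' * (cs.simple i * cs.simple i') ^ k) =
      cs.simple i' := by
  induction k with
  | zero => simp
  | succ k ih =>
    generalize hr : cs.simple i * cs.simple i' = r at ih ⊢
    have h : r * (cs.simple i' * r) = cs.simple i' := by simp [← hr, mul_assoc]
    calc r ^ (k + 1) * (cs.simple i' * r ^ (k + 1))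
        = r ^ k * r * (cs.simple i' * (r * r ^ k)) := by rw [← pow_succ, ← pow_succ']
      _ = r ^ k * (r * (cs.simple i' * r) * r ^ k) := by simp only [mul_assoc]
      _ = cs.simple i' := by rw [h, ih]

open Classical in
theorem signedConj_mul_pow_apply (i i' : B) (k : ℕ) (t : W) (e : ZMod 2) :
    ((cs.signedConj i * cs.signedConj i') ^ k) (t, e) =
      ((cs.simple i * cs.simple i') ^ k * t * ((cs.simple i * cs.simple i') ^ k)⁻¹,
        e + ∑ j ∈ Finset.range (2 * k),
          if t = cs.simple i' * (cs.simple i * cs.simple i') ^ j then 1 else 0) := by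
  induction k with
  | zero => simp
  | succ k ih =>
    have hk := cs.mul_simple_pow_mul i i' k
    generalize hr : cs.simple i * cs.simple i' = r at ih hk ⊢
    have h₁ : r ^ k * t * (r ^ k)⁻¹ = cs.simple i' ↔ t = cs.simple i' * r ^ (2 * k) := by
      rw [mul_inv_eq_iff_eq_mul, ← mul_right_inj (r ^ k) (b := t)]
      rw [two_mul, pow_add, ← mul_assoc (cs.simple i'), ← mul_assoc (r ^ k) (_ * _), hk]
    have h₂ : cs.simple i' * (r ^ k * t * (r ^ k)⁻¹) * cs.simple i' = cs.simple i ↔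
        t = cs.simple i' * r ^ (2 * k + 1) := by
      have : cs.simple i' * (r ^ k * t * (r ^ k)⁻¹) * cs.simple i' = cs.simple i ↔
          r ^ k * t * (r ^ k)⁻¹ = cs.simple i' * r := by
        rw [← mul_right_inj (cs.simple i'), ← mul_left_inj (cs.simple i')]
        simp [← hr, mul_assoc]
      rw [this, mul_inv_eq_iff_eq_mul, ← mul_right_inj (r ^ k) (b := t)]
      rw [show 2 * k + 1 = k + (1 + k) by ring, pow_add, pow_add, pow_one,
        ← mul_assoc (cs.simple i') (r ^ k), ← mul_assoc (r ^ k) (cs.simple i' * _), hk,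
        mul_assoc]
    rw [pow_succ', Equiv.Perm.mul_apply, ih, Equiv.Perm.mul_apply, signedConj_apply,
      signedConj_apply]
    ext
    · simp [← hr, pow_succ', mul_assoc]
    · rw [show 2 * (k + 1) = 2 * k + 1 + 1 by ring, Finset.sum_range_succ,
        Finset.sum_range_succ]
      simp only [h₁, h₂, add_assoc]

theorem isLiftable_signedConj : M.IsLiftable cs.signedConj := by
  classical
  intro i i'
  ext1 ⟨t, e⟩
  rw [signedConj_mul_pow_apply, two_mul, Finset.sum_range_add]
  simp [pow_add, CharTwo.add_self_eq_zero]

/-- The action of `W` on `W × ZMod 2` extending `signedConj`. -/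
noncomputable def signedConjHom : W →* Equiv.Perm (W × ZMod 2) :=
  cs.lift ⟨cs.signedConj, cs.isLiftable_signedConj⟩

/-- The parity of the number of occurrences of `t` in the right inversion sequence of any
word for `w`. -/
noncomputable def inversionParity (w t : W) : ZMod 2 := (cs.signedConjHom w (t, 0)).2

theorem signedConjHom_simple (i : B) : cs.signedConjHom (cs.simple i) = cs.signedConj i := by
  simp [signedConjHom]

theorem signedConjHom_apply (w t : W) (e : ZMod 2) :
    cs.signedConjHom w (t, e) = (w * t * w⁻¹, e + cs.inversionParity w t) := by
  unfold inversionParity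
  induction w using cs.simple_induction_left generalizing t e with
  | one => simp
  | mul_simple_left w i ih =>
    rw [map_mul, Equiv.Perm.mul_apply, Equiv.Perm.mul_apply, ih, ih t 0, signedConjHom_simple,
      signedConj_apply, signedConj_apply]
    ext <;> simp [mul_assoc, add_assoc]

theorem inversionParity_mul (w v t : W) :
    cs.inversionParity (w * v) t =
      cs.inversionParity v t + cs.inversionParity w (v * t * v⁻¹) := by
  rw [inversionParity, map_mul, Equiv.Perm.mul_apply, signedConjHom_apply, signedConjHom_apply]
  simp

theorem inversionParity_one (t : W) : cs.inversionParity 1 t = 0 := by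
  simp [inversionParity]

open Classical in
theorem inversionParity_simple (i : B) (t : W) :
    cs.inversionParity (cs.simple i) t = if t = cs.simple i then 1 else 0 := by
  simp [inversionParity, signedConjHom_simple, signedConj_apply]

open Classical in
theorem inversionParity_wordProd (ω : List B) (t : W) :
    cs.inversionParity (cs.wordProd ω) t = ((cs.rightInvSeq ω).count t : ZMod 2) := by
  induction ω with
  | nil => simp [inversionParity_one]
  | cons i ω ih =>
    have h : cs.wordProd ω * t * (cs.wordProd ω)⁻¹ = cs.simple i ↔
        (cs.wordProd ω)⁻¹ * cs.simple i * cs.wordProd ω = t := by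
      constructor
      · intro h
        rw [← h]
        group
      · rintro rfl
        group
    rw [wordProd_cons, inversionParity_mul, ih, inversionParity_simple, rightInvSeq,
      List.count_cons]
    simp [h]

theorem IsReduced.inversionParity_ne_zero_iff {cs : CoxeterSystem M W} {ω : List B}
    (hω : cs.IsReduced ω) (t : W) :
    cs.inversionParity (cs.wordProd ω) t ≠ 0 ↔ t ∈ cs.rightInvSeq ω := by
  classical
  rw [inversionParity_wordProd, hω.nodup_rightInvSeq.count]
  split_ifs with h <;> simp [h]

theorem isRightInversion_of_inversionParity_ne_zero {w t : W}
    (h : cs.inversionParity w t ≠ 0) : cs.IsRightInversion w t := by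
  obtain ⟨ω, hω, rfl⟩ := cs.exists_isReduced w
  exact cs.isRightInversion_of_mem_rightInvSeq hω ((hω.inversionParity_ne_zero_iff t).1 h)

theorem IsReflection.inversionParity_self {cs : CoxeterSystem M W} {t : W}
    (ht : cs.IsReflection t) : cs.inversionParity t t = 1 := by
  obtain ⟨u, i, rfl⟩ := ht
  have h := cs.inversionParity_mul u u⁻¹ (u * cs.simple i * u⁻¹)
  rw [mul_inv_cancel, inversionParity_one] at h
  rw [mul_assoc u, inversionParity_mul, inversionParity_mul, inversionParity_simple]
  simp only [mul_assoc, mul_inv_rev, inv_inv, inv_mul_cancel_left,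
    inv_mul_cancel, mul_one, inv_simple, simple_mul_simple_self, if_true] at h ⊢
  rw [add_right_comm, ← h, zero_add]

theorem inversionParity_ne_zero_iff (w t : W) :
    cs.inversionParity w t ≠ 0 ↔ cs.IsRightInversion w t := by
  refine ⟨cs.isRightInversion_of_inversionParity_ne_zero, fun ⟨ht, hlt⟩ h => ?_⟩
  have h' : cs.inversionParity (w * t) t ≠ 0 := by
    rw [inversionParity_mul, ht.inversionParity_self, mul_inv_cancel_right, h]
    simp
  have := (cs.isRightInversion_of_inversionParity_ne_zero h').2
  rw [mul_assoc, ht.mul_self, mul_one] at this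
  omega

theorem finite_and_ncard_setOf_isRightInversion (w : W) :
    {t | cs.IsRightInversion w t}.Finite ∧ {t | cs.IsRightInversion w t}.ncard = cs.length w := by
  classical
  obtain ⟨ω, hω, rfl⟩ := cs.exists_isReduced w
  have h : {t | cs.IsRightInversion (cs.wordProd ω) t} = (cs.rightInvSeq ω).toFinset := by
    ext t
    simp [← hω.inversionParity_ne_zero_iff, inversionParity_ne_zero_iff]
  rw [h, Set.ncard_coe_finset, List.toFinset_card_of_nodup hω.nodup_rightInvSeq,
    length_rightInvSeq, hω.eq]
  exact ⟨Finset.finite_toSet _, rfl⟩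

theorem mem_parabolic_of_isRightInversion {J : Set B} {v t : W} (hv : v ∈ cs.parabolic J)
    (h : cs.IsRightInversion v t) : t ∈ cs.parabolic J := by
  classical
  rw [← inversionParity_ne_zero_iff] at h
  contrapose! h
  unfold parabolic at hv
  induction hv using Subgroup.closure_induction generalizing t with
  | mem x hx =>
    obtain ⟨j, hj, rfl⟩ := hx
    rw [inversionParity_simple, if_neg]
    rintro rfl
    exact h (Subgroup.subset_closure ⟨j, hj, rfl⟩)
  | one => exact cs.inversionParity_one t
  | mul x y hx hy ihx ihy =>
    rw [inversionParity_mul, ihy h, ihx, zero_add]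
    rwa [(cs.parabolic J).mul_mem_cancel_right (inv_mem hy),
      (cs.parabolic J).mul_mem_cancel_left hy]
  | inv x hx ih =>
    have h' := cs.inversionParity_mul x x⁻¹ t
    rwa [mul_inv_cancel, inversionParity_one, ih, add_zero, eq_comm] at h'
    rwa [(cs.parabolic J).mul_mem_cancel_right (inv_mem (inv_mem hx)),
      (cs.parabolic J).mul_mem_cancel_left (inv_mem hx)]

theorem IsLongestIn.isRightInversion_iff {cs : CoxeterSystem M W} {J : Set B} {w t : W}
    (hw : cs.IsLongestIn J w) :
    cs.IsRightInversion w t ↔ cs.IsReflection t ∧ t ∈ cs.parabolic J :=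
  ⟨fun h => ⟨h.1, cs.mem_parabolic_of_isRightInversion hw.1 h⟩, fun ⟨ht, htJ⟩ =>
    ⟨ht, lt_of_le_of_ne (hw.2 _ (mul_mem hw.1 htJ)) (ht.length_mul_left_ne w)⟩⟩

theorem IsLongestIn.length_mul_add_length {cs : CoxeterSystem M W} {J : Set B} {w v : W}
    (hw : cs.IsLongestIn J w) (hv : v ∈ cs.parabolic J) :
    cs.length (w * v) + cs.length v = cs.length w := by
  have hdiff : {t | cs.IsRightInversion (w * v) t} =
      {t | cs.IsRightInversion w t} \ {t | cs.IsRightInversion v t} := by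
    ext t
    simp only [Set.mem_sdiff, Set.mem_ofPred_eq]
    by_cases ht : cs.IsReflection t ∧ t ∈ cs.parabolic J
    · have h₁ : cs.inversionParity w (v * t * v⁻¹) = 1 := by
        rw [show ∀ x : ZMod 2, x = 1 ↔ x ≠ 0 by decide, inversionParity_ne_zero_iff, hw.isRightInversion_iff]
        exact ⟨ht.1.conj v, mul_mem (mul_mem hv ht.2) (inv_mem hv)⟩
      simp only [hw.isRightInversion_iff, ht, ← cs.inversionParity_ne_zero_iff (w * v),
        ← cs.inversionParity_ne_zero_iff v, inversionParity_mul, h₁]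
      generalize cs.inversionParity v t = x
      revert x
      decide
    · refine iff_of_false (fun h => ht ⟨h.1, ?_⟩) fun h => ht (hw.isRightInversion_iff.1 h.1)
      exact cs.mem_parabolic_of_isRightInversion (mul_mem hw.1 hv) h
  have hsub : {t | cs.IsRightInversion v t} ⊆ {t | cs.IsRightInversion w t} := fun t ht =>
    hw.isRightInversion_iff.2 ⟨ht.1, cs.mem_parabolic_of_isRightInversion hv ht⟩
  rw [← (cs.finite_and_ncard_setOf_isRightInversion (w * v)).2,
    ← (cs.finite_and_ncard_setOf_isRightInversion v).2,
    ← (cs.finite_and_ncard_setOf_isRightInversion w).2, hdiff]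
  exact Set.ncard_sdiff_add_ncard_of_subset hsub (cs.finite_and_ncard_setOf_isRightInversion w).1

theorem IsLongestIn.mul_self {cs : CoxeterSystem M W} {J : Set B} {w : W}
    (hw : cs.IsLongestIn J w) : w * w = 1 := by
  have := hw.length_mul_add_length hw.1
  rw [← cs.length_eq_zero_iff]
  omega

theorem parabolic_mono {I J : Set B} (h : I ⊆ J) : cs.parabolic I ≤ cs.parabolic J :=
  Subgroup.closure_mono (Set.image_mono h)

end CoxeterSystem

/-- For `I ⊆ S`, `s ∈ S ∖ I` with `W_{I∪{s}}` finite, if conjugation by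
`w₀^{I∪{s}}` maps `I` onto `I`, then `σ_s := w₀^{I∪{s}} w₀^I` belongs to the set
`𝒲_I` of minimal-length elements normalizing `W_I`. -/
theorem sigma_mem_minNormalizing {B W : Type*} [Group W] {M : CoxeterMatrix B}
    (cs : CoxeterSystem M W) (I : Set B) (i : B) (hi : i ∉ I)
    (hfin : (cs.parabolic (insert i I) : Set W).Finite)
    (w₀Js w₀I : W) (hJs : cs.IsLongestIn (insert i I) w₀Js) (hI : cs.IsLongestIn I w₀I)
    (hconj : ∀ t ∈ I, ∃ t' ∈ I, w₀Js * cs.simple t * w₀Js⁻¹ = cs.simple t') :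
    w₀Js * w₀I ∈ cs.minNormalizing I := by
  have hconj_le : ∀ u ∈ cs.parabolic I, w₀Js * u * w₀Js⁻¹ ∈ cs.parabolic I := by
    have h : cs.parabolic I ≤
        (cs.parabolic I).comap (MulAut.conj w₀Js).toMonoidHom := by
      refine (Subgroup.closure_le _).2 ?_
      rintro _ ⟨t, ht, rfl⟩
      obtain ⟨t', ht', h⟩ := hconj t ht
      change w₀Js * cs.simple t * w₀Js⁻¹ ∈ cs.parabolic I
      rw [h]
      exact Subgroup.subset_closure ⟨t', ht', rfl⟩
    exact fun u hu => h hu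
  have hinv : w₀Js⁻¹ = w₀Js := inv_eq_of_mul_eq_one_left hJs.mul_self
  refine ⟨le_antisymm ?_ fun u hu => ?_, fun u hu => ?_⟩
  · rintro _ ⟨u, hu, rfl⟩
    have := hconj_le _ (mul_mem (mul_mem hI.1 hu) (inv_mem hI.1))
    simpa [mul_assoc] using this
  · refine ⟨w₀I⁻¹ * (w₀Js * u * w₀Js⁻¹) * w₀I,
      mul_mem (mul_mem (inv_mem hI.1) (hconj_le u hu)) hI.1, ?_⟩
    have hcancel : w₀Js * (w₀Js * u) = u := by rw [← mul_assoc, hJs.mul_self, one_mul]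
    simp [mul_assoc, hinv, hcancel, hJs.mul_self]
  · have hle := cs.parabolic_mono (Set.subset_insert i I)
    have huI := mul_mem hI.1 hu
    have h₁ := hJs.length_mul_add_length (hle hI.1)
    have h₂ := hJs.length_mul_add_length (hle huI)
    have h₃ := hI.2 _ huI
    rw [mul_assoc]
    omega
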